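/- For every x ≥ 0, Z^{(q)}(x) − α W^{(q)}(x) = (1 − α W^{(q)}(0)) ℤ^{(q)}(x) − α∫₀ˣ W^{(q)′}(y) ℤ^{(q)}(x−y) dy. -/

import Mathlib

open MeasureTheory Set Filter Topology

/-- The Laplace exponent of a spectrally negative Lévy process with triplet `(γ, σ, ν)`. -/
noncomputable def levyPsi (γ σ : ℝ) (ν : Measure ℝ) (l : ℝ) : ℝ :=
  γ * l + σ ^ 2 / 2 * l ^ 2 +
    ∫ z in Set.Ioi (0 : ℝ),
      (Real.exp (-l * z) - 1 +
        l * z * Set.indicator (Set.Ioc (0 : ℝ) 1) (fun _ => (1 : ℝ)) z) ∂ν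

/-- The right-inverse `Φ(q) = sup {λ ≥ 0 : f(λ) = q}` of a Laplace exponent `f`. -/
noncomputable def levyPhi (f : ℝ → ℝ) (q : ℝ) : ℝ :=
  sSup {l : ℝ | 0 ≤ l ∧ f l = q}

/-- `∫₀¹ z ν(dz)`, as an extended nonnegative real. -/
noncomputable def smallJumpMass (ν : Measure ℝ) : ENNReal :=
  ∫⁻ z in Set.Ioc (0 : ℝ) 1, ENNReal.ofReal z ∂ν

/-- `ν` is a Lévy measure on `(0,∞)`: it charges only `(0,∞)` and
integrates `min(1, z²)`. -/
def IsLevyMeasure (ν : Measure ℝ) : Prop :=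
  ν (Set.Iic 0) = 0 ∧ (∫⁻ z in Set.Ioi (0 : ℝ), ENNReal.ofReal (min 1 (z ^ 2)) ∂ν) ≠ ⊤

/-- The process is not the negative of a subordinator: `σ > 0`, or
`∫₀¹ z ν(dz) = ∞`, or `γ + ∫₀¹ z ν(dz) > 0`. -/
def NonDegenerate (γ σ : ℝ) (ν : Measure ℝ) : Prop :=
  0 < σ ∨ smallJumpMass ν = ⊤ ∨ 0 < γ + (smallJumpMass ν).toReal

/-- `W` is the `q`-scale function associated with the Laplace exponent `f`,
where `Φq` is the value of the right-inverse of `f` at `q`. -/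
def IsScaleFunction (f : ℝ → ℝ) (Φq q : ℝ) (W : ℝ → ℝ) : Prop :=
  (∀ x < 0, W x = 0) ∧ ContinuousOn W (Set.Ici 0) ∧ MonotoneOn W (Set.Ici 0) ∧
    ∀ l, Φq < l → (∫ y in Set.Ioi (0 : ℝ), Real.exp (-l * y) * W y) = 1 / (f l - q)

/-- Admissibility of the refraction parameter `α`: `α > 0`, and when the paths
have bounded variation (`σ = 0` and `∫₀¹ z ν(dz) < ∞`), `α` is smaller than the
drift `c = γ + ∫₀¹ z ν(dz)`. -/
def AlphaAdmissible (γ σ α : ℝ) (ν : Measure ℝ) : Prop :=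
  0 < α ∧ ((σ = 0 ∧ smallJumpMass ν ≠ ⊤) → α < γ + (smallJumpMass ν).toReal)

/-- If an integrable function on `(0,∞)` is orthogonal to all `y ↦ exp (-n y)`, it vanishes a.e. -/
theorem ae_eq_zero_of_integral_exp_neg_nat_mul_eq_zero {k : ℝ → ℝ} (hk : IntegrableOn k (Ioi 0))
    (h : ∀ n : ℕ, ∫ y in Ioi (0 : ℝ), Real.exp (-y) ^ n * k y = 0) :
    ∀ᵐ y, y ∈ Ioi (0 : ℝ) → k y = 0 := by
  have hmem : ∀ y ∈ Ioi (0 : ℝ), Real.exp (-y) ∈ Icc (0 : ℝ) 1 := fun y hy =>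
    ⟨(Real.exp_pos _).le, Real.exp_le_one_iff.2 (by simpa using (le_of_lt hy))⟩
  have hmul : ∀ φ : ℝ → ℝ, ContinuousOn φ (Icc 0 1) →
      IntegrableOn (fun y => φ (Real.exp (-y)) * k y) (Ioi 0) := by
    intro φ hφ
    obtain ⟨C, hC⟩ := isCompact_Icc.exists_bound_of_continuousOn hφ
    refine hk.bdd_mul (c := C) ?_ ?_
    · exact (hφ.comp (by fun_prop) hmem).aestronglyMeasurable measurableSet_Ioi
    · filter_upwards [ae_restrict_mem measurableSet_Ioi] with y hy using hC _ (hmem y hy)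
  have hpoly : ∀ p : Polynomial ℝ,
      ∫ y in Ioi (0 : ℝ), p.eval (Real.exp (-y)) * k y = 0 := by
    intro p
    induction p using Polynomial.induction_on' with
    | add p r hp hr =>
      simp only [Polynomial.eval_add, add_mul]
      rw [integral_add (hmul (fun u => p.eval u) p.continuous.continuousOn)
        (hmul (fun u => r.eval u) r.continuous.continuousOn), hp, hr, add_zero]
    | monomial n a =>
      simp only [Polynomial.eval_monomial, mul_assoc]
      rw [integral_const_mul, h n, mul_zero]
  have hcont : ∀ φ : ℝ → ℝ, ContinuousOn φ (Icc 0 1) →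
      ∫ y in Ioi (0 : ℝ), φ (Real.exp (-y)) * k y = 0 := by
    intro φ hφ
    set K := ∫ y in Ioi (0 : ℝ), |k y|
    have hK : 0 ≤ K := integral_nonneg fun _ => abs_nonneg _
    refine abs_eq_zero.1 (le_antisymm (le_of_forall_pos_le_add fun ε hε => ?_) (abs_nonneg _))
    obtain ⟨p, hp⟩ := exists_polynomial_near_of_continuousOn 0 1 φ hφ (ε / (K + 1))
      (by positivity)
    have hpint := hmul (fun u => p.eval u) p.continuous.continuousOn
    calc |∫ y in Ioi (0 : ℝ), φ (Real.exp (-y)) * k y|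
        = ‖∫ y in Ioi (0 : ℝ), (φ (Real.exp (-y)) * k y - p.eval (Real.exp (-y)) * k y)‖ := by
          rw [integral_sub (hmul φ hφ) hpint, hpoly p, sub_zero, Real.norm_eq_abs]
      _ ≤ ∫ y in Ioi (0 : ℝ), ε / (K + 1) * |k y| := by
          refine norm_integral_le_of_norm_le (hk.abs.const_mul _) ?_
          filter_upwards [ae_restrict_mem measurableSet_Ioi] with y hy
          rw [← sub_mul, norm_mul, Real.norm_eq_abs, Real.norm_eq_abs, abs_sub_comm]
          exact mul_le_mul_of_nonneg_right (hp _ (hmem y hy)).le (abs_nonneg _)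
      _ = ε * (K / (K + 1)) := by rw [integral_const_mul]; ring
      _ ≤ 0 + ε := by
          rw [zero_add]
          exact mul_le_of_le_one_right hε.le ((div_le_one (by positivity)).2 (by linarith))
  refine isOpen_Ioi.ae_eq_zero_of_integral_contDiff_smul_eq_zero hk.locallyIntegrableOn
    fun ζ hζ hζc hζs => ?_
  have hζ0 : ∀ y ≤ 0, ζ y = 0 := fun y hy =>
    image_eq_zero_of_notMem_tsupport fun hmem => not_lt.2 hy (hζs hmem)
  have hφ : Continuous fun u => ζ (-Real.log u) := by
    refine continuous_iff_continuousAt.2 fun u => ?_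
    rcases eq_or_ne u 0 with rfl | hu
    · have hlim : Tendsto (fun u => -Real.log u) (𝓝[≠] 0) atTop :=
        tendsto_neg_atBot_atTop.comp Real.tendsto_log_nhdsNE_zero
      have hz : ∀ᶠ u in 𝓝[≠] (0 : ℝ), ζ (-Real.log u) = 0 := by
        obtain ⟨R, hR⟩ := hζc.isCompact.bddAbove
        filter_upwards [hlim.eventually_gt_atTop R] with u hu
        exact image_eq_zero_of_notMem_tsupport fun hmem => not_lt.2 (hR hmem) hu
      rw [continuousAt_iff_punctured_nhds]
      simp only [Real.log_zero, neg_zero, hζ0 0 le_rfl]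
      exact tendsto_const_nhds.congr' (hz.mono fun _ h => h.symm)
    · exact ContinuousAt.comp (f := fun u => -Real.log u) (g := ζ)
        hζ.continuous.continuousAt (Real.continuousAt_log hu).neg
  rw [← setIntegral_eq_integral_of_forall_compl_eq_zero (s := Ioi 0)]
  · simpa using hcont _ hφ.continuousOn
  · intro y hy
    simp [hζ0 y (not_lt.1 hy)]

/-- Uniqueness of the Laplace transform for continuous functions on `[0,∞)`. -/
theorem eqOn_zero_of_laplace_eq_zero {g : ℝ → ℝ} (hg : ContinuousOn g (Ici 0)) {l₀ : ℝ}
    (hint : ∀ l, l₀ < l → IntegrableOn (fun y => Real.exp (-l * y) * g y) (Ioi 0))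
    (h : ∀ l, l₀ < l → ∫ y in Ioi (0 : ℝ), Real.exp (-l * y) * g y = 0) :
    ∀ x, 0 ≤ x → g x = 0 := by
  have hae := ae_eq_zero_of_integral_exp_neg_nat_mul_eq_zero (hint (l₀ + 1) (by linarith))
    fun n => by
      refine Eq.trans ?_ (h (l₀ + 1 + n) (by linarith [n.cast_nonneg (α := ℝ)]))
      congr 1 with y
      rw [← Real.exp_nat_mul, ← mul_assoc, ← Real.exp_add]
      ring_nf
  have hae' : g =ᵐ[volume.restrict (Ici 0)] 0 := by
    rw [← restrict_Ioi_eq_restrict_Ici, EventuallyEq, ae_restrict_iff' measurableSet_Ioi]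
    filter_upwards [hae] with y hy hy0
    exact (mul_eq_zero.1 (hy hy0)).resolve_left (Real.exp_ne_zero _)
  exact fun x hx => Measure.eqOn_of_ae_eq hae' hg continuousOn_const (by simp) hx

/-- The Laplace transform of a convolution is the product of the Laplace transforms. -/
theorem laplace_convolution {U V : ℝ → ℝ} {l : ℝ}
    (hU : IntegrableOn (fun y => Real.exp (-l * y) * U y) (Ioi 0))
    (hV : IntegrableOn (fun y => Real.exp (-l * y) * V y) (Ioi 0)) :
    IntegrableOn (fun x => Real.exp (-l * x) * ∫ t in (0 : ℝ)..x, U t * V (x - t)) (Ioi 0) ∧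
      ∫ x in Ioi (0 : ℝ), Real.exp (-l * x) * ∫ t in (0 : ℝ)..x, U t * V (x - t) =
        (∫ y in Ioi (0 : ℝ), Real.exp (-l * y) * U y) *
          ∫ y in Ioi (0 : ℝ), Real.exp (-l * y) * V y := by
  have hexp : ∀ x, Real.exp (-l * x) * ∫ t in (0 : ℝ)..x, U t * V (x - t) =
      ∫ t in (0 : ℝ)..x, ContinuousLinearMap.mul ℝ ℝ (Real.exp (-l * t) * U t)
        (Real.exp (-l * (x - t)) * V (x - t)) := by
    intro x
    rw [← intervalIntegral.integral_const_mul]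
    congr 1 with t
    rw [ContinuousLinearMap.mul_apply', show -l * x = -l * t + -l * (x - t) by ring, Real.exp_add]
    ring
  simp_rw [hexp]
  refine ⟨?_, integral_posConvolution hU hV (ContinuousLinearMap.mul ℝ ℝ)⟩
  exact (integrable_indicator_iff measurableSet_Ioi).1
    (integrable_posConvolution hU hV (ContinuousLinearMap.mul ℝ ℝ))

/-- An algebraic relation between Laplace transforms turned into a convolution identity. -/
theorem convolution_eq_of_laplace {U V : ℝ → ℝ} (hUc : Continuous U) (hVc : Continuous V)
    {α l₀ : ℝ} (hl₀ : 0 ≤ l₀)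
    (hU : ∀ l, l₀ < l → IntegrableOn (fun y => Real.exp (-l * y) * U y) (Ioi 0))
    (hV : ∀ l, l₀ < l → IntegrableOn (fun y => Real.exp (-l * y) * V y) (Ioi 0))
    (h : ∀ l, l₀ < l → α * l * ((∫ y in Ioi (0 : ℝ), Real.exp (-l * y) * U y) *
        ∫ y in Ioi (0 : ℝ), Real.exp (-l * y) * V y) =
      (∫ y in Ioi (0 : ℝ), Real.exp (-l * y) * V y) -
        ∫ y in Ioi (0 : ℝ), Real.exp (-l * y) * U y)
    {x : ℝ} (hx : 0 ≤ x) :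
    α * ∫ t in (0 : ℝ)..x, U t * V (x - t) =
      (∫ t in (0 : ℝ)..x, V t) - ∫ t in (0 : ℝ)..x, U t := by
  have hone : ∀ l, l₀ < l → IntegrableOn (fun y => Real.exp (-l * y) * (1 : ℝ)) (Ioi 0) :=
    fun l hl => by simpa using integrableOn_exp_mul_Ioi (a := -l) (by linarith) 0
  have hone' : ∀ l, l₀ < l → ∫ y in Ioi (0 : ℝ), Real.exp (-l * y) * (1 : ℝ) = 1 / l :=
    fun l hl => by
      simp_rw [mul_one]
      simp [-neg_mul, integral_exp_mul_Ioi (a := -l) (by linarith) 0]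
  have hsplit : ∀ l y,
      Real.exp (-l * y) * (α * (∫ t in (0 : ℝ)..y, U t * V (y - t)) -
        (∫ t in (0 : ℝ)..y, V t * 1) + ∫ t in (0 : ℝ)..y, U t * 1) =
      α * (Real.exp (-l * y) * ∫ t in (0 : ℝ)..y, U t * V (y - t)) -
        Real.exp (-l * y) * (∫ t in (0 : ℝ)..y, V t * 1) +
        Real.exp (-l * y) * ∫ t in (0 : ℝ)..y, U t * 1 := fun l y => by ring
  have key := eqOn_zero_of_laplace_eq_zero
    (g := fun y => α * (∫ t in (0 : ℝ)..y, U t * V (y - t)) -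
      (∫ t in (0 : ℝ)..y, V t * 1) + ∫ t in (0 : ℝ)..y, U t * 1) (l₀ := l₀) ?_ ?_ ?_ x hx
  · simp only [mul_one] at key
    linarith
  · refine Continuous.continuousOn ((Continuous.sub (continuous_const.mul ?_) ?_).add ?_)
    all_goals
      exact intervalIntegral.continuous_parametric_intervalIntegral_of_continuous
        (by fun_prop) continuous_id
  · intro l hl
    simp_rw [hsplit]
    exact (((laplace_convolution (hU l hl) (hV l hl)).1.const_mul α).sub
      (laplace_convolution (hV l hl) (hone l hl)).1).add
      (laplace_convolution (hU l hl) (hone l hl)).1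
  · intro l hl
    have hUV := laplace_convolution (hU l hl) (hV l hl)
    have hV1 := laplace_convolution (hV l hl) (hone l hl)
    have hU1 := laplace_convolution (hU l hl) (hone l hl)
    have hsub : IntegrableOn (fun y => α * (Real.exp (-l * y) *
        ∫ t in (0 : ℝ)..y, U t * V (y - t)) -
          Real.exp (-l * y) * ∫ t in (0 : ℝ)..y, V t * 1) (Ioi 0) :=
      (hUV.1.const_mul α).sub hV1.1
    simp_rw [hsplit]
    rw [integral_add hsub hU1.1,
      integral_sub (hUV.1.const_mul α) hV1.1, integral_const_mul, hUV.2, hV1.2, hU1.2, hone' l hl]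
    have hl' : l ≠ 0 := by linarith
    have hl_eq := h l hl
    set A := ∫ y in Ioi (0 : ℝ), Real.exp (-l * y) * U y
    set B := ∫ y in Ioi (0 : ℝ), Real.exp (-l * y) * V y
    field_simp
    linear_combination hl_eq

/-- The compensated jump integrand is dominated by `(1 + l²) min(1, z²)`. -/
theorem abs_levy_integrand_le {l z : ℝ} (hl : 0 ≤ l) (hz : 0 < z) :
    |Real.exp (-l * z) - 1 + l * z * Set.indicator (Set.Ioc (0 : ℝ) 1) (fun _ => (1 : ℝ)) z| ≤
      (1 + l ^ 2) * min 1 (z ^ 2) := by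
  have hu : 0 ≤ l * z := by positivity
  rcases le_or_gt z 1 with h1 | h1
  · rw [indicator_of_mem (show z ∈ Ioc (0 : ℝ) 1 from ⟨hz, h1⟩), mul_one,
      min_eq_right (by nlinarith : z ^ 2 ≤ 1)]
    have hlow : 0 ≤ Real.exp (-l * z) - 1 + l * z := by
      linarith [Real.add_one_le_exp (-l * z)]
    have hup : Real.exp (-l * z) - 1 + l * z ≤ (l * z) ^ 2 := by
      rcases le_or_gt (l * z) 1 with h2 | h2
      · have := (abs_le.1 (Real.abs_exp_sub_one_sub_id_le (x := -l * z)
          (by rwa [neg_mul, abs_neg, abs_of_nonneg hu]))).2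
        nlinarith
      · have : Real.exp (-l * z) ≤ 1 := Real.exp_le_one_iff.2 (by linarith)
        nlinarith
    rw [abs_of_nonneg hlow]
    nlinarith [sq_nonneg z]
  · rw [indicator_of_notMem (fun h : z ∈ Ioc (0 : ℝ) 1 => not_lt.2 h.2 h1), mul_zero, add_zero,
      min_eq_left (by nlinarith : 1 ≤ z ^ 2), abs_le]
    have hpos := Real.exp_pos (-l * z)
    have : Real.exp (-l * z) ≤ 1 := Real.exp_le_one_iff.2 (by linarith)
    constructor <;> nlinarith [sq_nonneg l]

theorem integrableOn_levy_integrand {ν : Measure ℝ} (hν : IsLevyMeasure ν) {l : ℝ} (hl : 0 ≤ l) :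
    IntegrableOn (fun z => Real.exp (-l * z) - 1 +
      l * z * Set.indicator (Set.Ioc (0 : ℝ) 1) (fun _ => (1 : ℝ)) z) (Ioi 0) ν := by
  have hmin : IntegrableOn (fun z : ℝ => min 1 (z ^ 2)) (Ioi 0) ν :=
    (lintegral_ofReal_ne_top_iff_integrable (by fun_prop)
      (Eventually.of_forall fun z => by positivity)).1 hν.2
  refine (hmin.const_mul (1 + l ^ 2)).mono' ?_ ?_
  · refine Measurable.aestronglyMeasurable (Measurable.add (by fun_prop) (Measurable.mul
      (by fun_prop) (measurable_const.indicator measurableSet_Ioc)))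
  · filter_upwards [ae_restrict_mem measurableSet_Ioi] with z hz
    exact abs_levy_integrand_le hl hz

/-- A consequence of the convexity of the Laplace exponent and its vanishing at `0`. -/
theorem levyPsi_mul_le {γ σ : ℝ} {ν : Measure ℝ} (hν : IsLevyMeasure ν) {θ l : ℝ}
    (hθ₀ : 0 ≤ θ) (hθ₁ : θ ≤ 1) (hl : 0 ≤ l) :
    levyPsi γ σ ν (θ * l) ≤ θ * levyPsi γ σ ν l := by
  have hint : (∫ z in Ioi (0 : ℝ), (Real.exp (-(θ * l) * z) - 1 +
        θ * l * z * Set.indicator (Set.Ioc (0 : ℝ) 1) (fun _ => (1 : ℝ)) z) ∂ν) ≤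
      ∫ z in Ioi (0 : ℝ), θ * (Real.exp (-l * z) - 1 +
        l * z * Set.indicator (Set.Ioc (0 : ℝ) 1) (fun _ => (1 : ℝ)) z) ∂ν := by
    refine integral_mono (integrableOn_levy_integrand hν (mul_nonneg hθ₀ hl))
      ((integrableOn_levy_integrand hν hl).const_mul θ) fun z => ?_
    have hconv := convexOn_exp.2 (mem_univ (-l * z)) (mem_univ 0) hθ₀ (sub_nonneg.2 hθ₁)
      (add_sub_cancel θ 1)
    simp only [smul_eq_mul, mul_zero, add_zero, Real.exp_zero, mul_one] at hconv
    rw [show θ * (-l * z) = -(θ * l) * z by ring] at hconv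
    dsimp only
    linarith
  rw [integral_const_mul] at hint
  have hsq : σ ^ 2 / 2 * (θ * l) ^ 2 ≤ θ * (σ ^ 2 / 2 * l ^ 2) := by
    have : 0 ≤ (σ ^ 2 / 2 * l ^ 2) * (θ * (1 - θ)) :=
      mul_nonneg (by positivity) (mul_nonneg hθ₀ (sub_nonneg.2 hθ₁))
    linarith
  unfold levyPsi
  linarith

theorem levyPhi_nonneg (f : ℝ → ℝ) (q : ℝ) : 0 ≤ levyPhi f q :=
  Real.sSup_nonneg fun _ hl => hl.1

/-- If `f` lies below its chords from the origin, it does not take a positive value `q` beyond its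
right-inverse at `q`. -/
theorem ne_of_levyPhi_lt {f : ℝ → ℝ}
    (hf : ∀ θ l : ℝ, 0 ≤ θ → θ ≤ 1 → 0 ≤ l → f (θ * l) ≤ θ * f l) {q l : ℝ} (hq : 0 < q)
    (hl : levyPhi f q < l) : f l ≠ q := by
  intro hfl
  have hl₀ : 0 < l := (levyPhi_nonneg f q).trans_lt hl
  refine not_le.2 hl (le_csSup ⟨l, fun m ⟨hm, hfm⟩ => ?_⟩ ⟨hl₀.le, hfl⟩)
  by_contra! hlm
  have hm₀ : 0 < m := hl₀.trans hlm
  have hle := hf (l / m) m (by positivity) ((div_le_one hm₀).2 hlm.le) hm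
  rw [div_mul_cancel₀ l hm₀.ne', hfl, hfm] at hle
  exact not_lt.2 hle (mul_lt_of_lt_one_left hq ((div_lt_one hm₀).2 hlm))

theorem IsScaleFunction.integrableOn {f W : ℝ → ℝ} {Φq q l : ℝ} (hW : IsScaleFunction f Φq q W)
    (hl : Φq < l) (hne : f l ≠ q) : IntegrableOn (fun y => Real.exp (-l * y) * W y) (Ioi 0) :=
  not_imp_comm.1 integral_undef <| by
    rw [hW.2.2.2 l hl]
    exact one_div_ne_zero (sub_ne_zero.2 hne)

theorem continuous_comp_max_zero {f : ℝ → ℝ} (hf : ContinuousOn f (Ici 0)) :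
    Continuous fun y => f (max y 0) :=
  hf.comp_continuous (by fun_prop) fun y => le_max_right y 0

/-- The resolvent-type identity linking the scale functions of `f` and `f - α · id`. -/
theorem IsScaleFunction.convolution_eq {f W Wα : ℝ → ℝ} {α q : ℝ} (hq : 0 < q)
    (hf : ∀ θ l : ℝ, 0 ≤ θ → θ ≤ 1 → 0 ≤ l → f (θ * l) ≤ θ * f l)
    (hW : IsScaleFunction f (levyPhi f q) q W)
    (hWα : IsScaleFunction (fun l => f l - α * l) (levyPhi (fun l => f l - α * l) q) q Wα)
    {x : ℝ} (hx : 0 ≤ x) :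
    α * ∫ t in (0 : ℝ)..x, W t * Wα (x - t) =
      (∫ t in (0 : ℝ)..x, Wα t) - ∫ t in (0 : ℝ)..x, W t := by
  set l₀ := max (levyPhi f q) (levyPhi (fun l => f l - α * l) q)
  have hne : ∀ l, l₀ < l → f l ≠ q := fun l hl =>
    ne_of_levyPhi_lt hf hq ((le_max_left _ _).trans_lt hl)
  have hneα : ∀ l, l₀ < l → f l - α * l ≠ q := fun l hl =>
    ne_of_levyPhi_lt (f := fun l => f l - α * l)
      (fun θ l h₀ h₁ hl => by linarith [hf θ l h₀ h₁ hl]) hq ((le_max_right _ _).trans_lt hl)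
  have hext : ∀ (F : ℝ → ℝ) (l : ℝ), EqOn (fun y => Real.exp (-l * y) * F y)
      (fun y => Real.exp (-l * y) * F (max y 0)) (Ioi 0) := fun F l y hy => by
    simp only [max_eq_left (le_of_lt (mem_Ioi.1 hy))]
  have key := convolution_eq_of_laplace (α := α) (l₀ := l₀) (continuous_comp_max_zero hW.2.1)
    (continuous_comp_max_zero hWα.2.1) ((levyPhi_nonneg _ _).trans (le_max_left _ _))
    (fun l hl => (hW.integrableOn ((le_max_left _ _).trans_lt hl) (hne l hl)).congr_fun
      (hext W l) measurableSet_Ioi)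
    (fun l hl => (hWα.integrableOn ((le_max_right _ _).trans_lt hl) (hneα l hl)).congr_fun
      (hext Wα l) measurableSet_Ioi) ?_ hx
  · convert key using 2
    · refine intervalIntegral.integral_congr fun t ht => ?_
      rw [uIcc_of_le hx] at ht
      simp only [max_eq_left ht.1, max_eq_left (sub_nonneg.2 ht.2)]
    all_goals
      refine intervalIntegral.integral_congr fun t ht => ?_
      rw [uIcc_of_le hx] at ht
      simp only [max_eq_left ht.1]
  · intro l hl
    rw [← setIntegral_congr_fun measurableSet_Ioi (hext W l),
      ← setIntegral_congr_fun measurableSet_Ioi (hext Wα l),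
      hW.2.2.2 l ((le_max_left _ _).trans_lt hl), hWα.2.2.2 l ((le_max_right _ _).trans_lt hl)]
    have h₁ := sub_ne_zero.2 (hne l hl)
    have h₂ := sub_ne_zero.2 (hneα l hl)
    field_simp
    ring

/-- For every `x ≥ 0`,
`Z^{(q)}(x) - α W^{(q)}(x)
  = (1 - α W^{(q)}(0)) ℤ^{(q)}(x) - α∫₀ˣ W^{(q)′}(y) ℤ^{(q)}(x-y) dy`,
where `Z^{(q)}(x) = 1 + q∫₀ˣ W^{(q)}` and `ℤ^{(q)}(x) = 1 + q∫₀ˣ 𝕎^{(q)}`. -/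
theorem Z_scale_function_convolution
    (γ σ : ℝ) (hσ : 0 ≤ σ) (ν : Measure ℝ) (hν : IsLevyMeasure ν)
    (hnd : NonDegenerate γ σ ν)
    (α : ℝ) (hα : AlphaAdmissible γ σ α ν)
    (q : ℝ) (hq : 0 ≤ q)
    (W W' Wα : ℝ → ℝ)
    (hW : IsScaleFunction (levyPsi γ σ ν) (levyPhi (levyPsi γ σ ν) q) q W)
    (hW' : (∀ y : ℝ, 0 < y → HasDerivAt W (W' y) y) ∧ ContinuousOn W' (Set.Ioi 0))
    (hWα : IsScaleFunction (fun l => levyPsi γ σ ν l - α * l)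
      (levyPhi (fun l => levyPsi γ σ ν l - α * l) q) q Wα) :
    ∀ x : ℝ, 0 ≤ x →
      (1 + q * ∫ y in (0:ℝ)..x, W y) - α * W x =
        (1 - α * W 0) * (1 + q * ∫ y in (0:ℝ)..x, Wα y) -
          α * ∫ y in (0:ℝ)..x, W' y * (1 + q * ∫ z in (0:ℝ)..(x - y), Wα z) := by
  intro x hx
  have hWc : ContinuousOn W (uIcc 0 x) := hW.2.1.mono fun y hy => by
    rw [uIcc_of_le hx] at hy
    exact hy.1
  have hderiv : ∀ y ∈ Ioo (min 0 x) (max 0 x), HasDerivAt W (W' y) y := fun y hy => by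
    rw [min_eq_left hx] at hy
    exact hW'.1 y hy.1
  have hint : IntervalIntegrable W' volume 0 x := by
    refine intervalIntegral.intervalIntegrable_deriv_of_nonneg hWc hderiv fun y hy => ?_
    rw [min_eq_left hx] at hy
    rw [← ((hW'.1 y hy.1).hasDerivWithinAt (s := Ici 0)).derivWithin
      (uniqueDiffOn_Ici 0 y hy.1.le)]
    exact hW.2.2.1.derivWithin_nonneg
  set V : ℝ → ℝ := fun y => Wα (max y 0)
  have hVc : Continuous V := continuous_comp_max_zero hWα.2.1
  have hVint : ∀ u, 0 ≤ u → ∫ z in (0 : ℝ)..u, Wα z = ∫ z in (0 : ℝ)..u, V z := fun u hu =>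
    intervalIntegral.integral_congr fun z hz => by
      rw [uIcc_of_le hu] at hz
      simp only [V, max_eq_left hz.1]
  have hprim : ∀ y, HasDerivAt (fun y => 1 + q * ∫ z in (0 : ℝ)..(x - y), V z)
      (-(q * V (x - y))) y := fun y => by
    have h := (hVc.integral_hasStrictDerivAt 0 (x - y)).hasDerivAt.comp y
      ((hasDerivAt_id y).const_sub x)
    simpa using! (h.const_mul q).const_add 1
  have hVx : Continuous fun y => -(q * V (x - y)) := by fun_prop
  have hprimc : Continuous fun y => 1 + q * ∫ z in (0 : ℝ)..(x - y), V z :=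
    continuous_iff_continuousAt.2 fun y => (hprim y).continuousAt
  have hparts := intervalIntegral.integral_deriv_mul_eq_sub_of_hasDerivAt hWc hprimc.continuousOn
    hderiv (fun y _ => hprim y) hint (hVx.intervalIntegrable 0 x)
  rw [intervalIntegral.integral_add (hint.mul_continuousOn hprimc.continuousOn)
    (ContinuousOn.intervalIntegrable (u := fun y => W y * -(q * V (x - y)))
      (hWc.mul hVx.continuousOn))] at hparts
  have hconv : ∫ y in (0 : ℝ)..x, W y * -(q * V (x - y)) =
      -(q * ∫ y in (0 : ℝ)..x, W y * Wα (x - y)) := by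
    rw [← intervalIntegral.integral_const_mul, ← intervalIntegral.integral_neg]
    refine intervalIntegral.integral_congr fun y hy => ?_
    rw [uIcc_of_le hx] at hy
    simp only [V, max_eq_left (sub_nonneg.2 hy.2)]
    ring
  have hlhs : ∫ y in (0 : ℝ)..x, W' y * (1 + q * ∫ z in (0 : ℝ)..(x - y), Wα z) =
      ∫ y in (0 : ℝ)..x, W' y * (1 + q * ∫ z in (0 : ℝ)..(x - y), V z) :=
    intervalIntegral.integral_congr fun y hy => by
      rw [uIcc_of_le hx] at hy
      simp only [hVint (x - y) (sub_nonneg.2 hy.2)]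
  rw [hconv, sub_self, intervalIntegral.integral_same, sub_zero, ← hVint x hx] at hparts
  have hkey : q * (α * ∫ y in (0 : ℝ)..x, W y * Wα (x - y)) =
      q * ((∫ y in (0 : ℝ)..x, Wα y) - ∫ y in (0 : ℝ)..x, W y) := by
    rcases hq.eq_or_lt with rfl | hq
    · simp
    · rw [hW.convolution_eq hq (fun θ l h₀ h₁ hl => levyPsi_mul_le hν h₀ h₁ hl) hWα hx]
  rw [hlhs]
  linear_combination α * hparts + hkey
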